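/- arXiv:1911.13013 — 2 statements merged into one kernel-verified Lean document; each statement's English description precedes it below -/
import Mathlib

section
/- For every binary path P of length n starting with a downstep, the number f(P) of chains with small intervals and minimum length from P to 1_n equals the number of strictly increasing shifted tableaux of shape λ(P) whose maximum entry equals δ(P) = n − 1 − lv(P). -/
open Finset

/-- The `x`-th step (1-indexed) of a binary path `P` of length `n`;
`true` denotes an upstep `u`, `false` a downstep `d`. -/
def stp (n : ℕ) (P : Fin n → Bool) (x : ℕ) : Bool :=
  if h : 1 ≤ x ∧ x ≤ n then P ⟨x - 1, by omega⟩ else true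

/-- The height of the `x`-th lattice point of the path (the partial sum of `±1`'s). -/
def ht (n : ℕ) (P : Fin n → Bool) (x : ℕ) : ℤ :=
  ∑ j ∈ Finset.Icc 1 x, (if stp n P j then (1 : ℤ) else -1)

/-- The order on binary paths: `P ≤ Q` iff every height of `P` is at most that of `Q`. -/
def pLE (n : ℕ) (P Q : Fin n → Bool) : Prop := ∀ x ≤ n, ht n P x ≤ ht n Q x

def pLT (n : ℕ) (P Q : Fin n → Bool) : Prop := pLE n P Q ∧ ¬ pLE n Q P

/-- `Q` covers `P` in the lattice of binary paths. -/
def covers (n : ℕ) (P Q : Fin n → Bool) : Prop :=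
  pLT n P Q ∧ ∀ R, pLT n P R → ¬ pLT n R Q

/-- The `x`-th point of `P` is a valley: last point of a maximal run of downsteps. -/
def valley (n : ℕ) (P : Fin n → Bool) (x : ℕ) : Prop :=
  1 ≤ x ∧ x ≤ n ∧ stp n P x = false ∧ (x = n ∨ stp n P (x + 1) = true)

/-- The maximum path `1_n = u^n`. -/
def pTop (n : ℕ) : Fin n → Bool := fun _ => true

/-- The minimum path `0_n = d^n`. -/
def pBot (n : ℕ) : Fin n → Bool := fun _ => false

/-- The set of positions of downsteps of `P`. -/
def dsteps (n : ℕ) (P : Fin n → Bool) : Finset (Fin n) :=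
  Finset.univ.filter fun j => P j = false

/-- `m(P) = |P|_d`, the number of downsteps of `P`. -/
def nd (n : ℕ) (P : Fin n → Bool) : ℕ := (dsteps n P).card

/-- The 0-indexed position of the `(i+1)`-st downstep of `P`. -/
def dpos (n : ℕ) (P : Fin n → Bool) (i : Fin (nd n P)) : ℕ :=
  (((dsteps n P).orderIsoOfFin rfl i : {x // x ∈ dsteps n P}) : Fin n)

/-- The part `λ_{i+1} = n − (i+1) − k_{i+1} + 1` of the strict partition `λ(P)`;
since `k_{i+1} = dpos i − i`, this equals `n − dpos i`. -/
def lam (n : ℕ) (P : Fin n → Bool) (i : Fin (nd n P)) : ℕ := n - dpos n P i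

/-- The shifted diagram `F(P)` of shape `λ(P)`, as the set of (1-indexed) cells
`(i, j)` with `i ∈ [m]`, `i ≤ j ≤ λ_i + i − 1`. -/
def F (n : ℕ) (P : Fin n → Bool) : Set (ℕ × ℕ) :=
  {c | ∃ i : Fin (nd n P),
    c.1 = (i : ℕ) + 1 ∧ (i : ℕ) + 1 ≤ c.2 ∧ c.2 ≤ lam n P i + (i : ℕ)}

/-- The `x`-coordinate `n + i − j` of the lattice point of cell `c = (i,j)`. -/
def cellX (n : ℕ) (c : ℕ × ℕ) : ℕ := n + c.1 - c.2

/-- The `y`-coordinate `n − i − j` of the lattice point of cell `c = (i,j)`. -/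
def cellY (n : ℕ) (c : ℕ × ℕ) : ℤ := (n : ℤ) - c.1 - c.2

/-- A shifted tableau of shape `λ(P)`: positive entries, weakly increasing along
rows and columns. -/
def isTab (n : ℕ) (P : Fin n → Bool) (T : {c : ℕ × ℕ // c ∈ F n P} → ℕ) : Prop :=
  (∀ c, 0 < T c) ∧
  (∀ c c' : {c : ℕ × ℕ // c ∈ F n P},
    c.1.1 = c'.1.1 → c.1.2 + 1 = c'.1.2 → T c ≤ T c') ∧
  (∀ c c' : {c : ℕ × ℕ // c ∈ F n P},
    c.1.1 + 1 = c'.1.1 → c.1.2 = c'.1.2 → T c ≤ T c')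

/-- A shifted tableau is strictly increasing along rows and columns. -/
def isStrictTab (n : ℕ) (P : Fin n → Bool)
    (T : {c : ℕ × ℕ // c ∈ F n P} → ℕ) : Prop :=
  (∀ c c' : {c : ℕ × ℕ // c ∈ F n P},
    c.1.1 = c'.1.1 → c.1.2 + 1 = c'.1.2 → T c < T c') ∧
  (∀ c c' : {c : ℕ × ℕ // c ∈ F n P},
    c.1.1 + 1 = c'.1.1 → c.1.2 = c'.1.2 → T c < T c')

/-- A multichain `P = P_0 ≤ P_1 ≤ ⋯ ≤ P_k = u^n`. -/
def isMultichain (n k : ℕ) (P : Fin n → Bool)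
    (C : Fin (k + 1) → Fin n → Bool) : Prop :=
  (∀ i : Fin k, pLE n (C i.castSucc) (C i.succ)) ∧ C 0 = P ∧ C (Fin.last k) = pTop n

/-- The defining relation of the bijection: the entry at cell `(i,j)` is `k − ξ`
for the unique `ξ` with `h_{n+i−j}(P_ξ) ≤ n − i − j < h_{n+i−j}(P_{ξ+1})`. -/
def corr (n k : ℕ) (P : Fin n → Bool) (C : Fin (k + 1) → Fin n → Bool)
    (T : {c : ℕ × ℕ // c ∈ F n P} → ℕ) : Prop :=
  ∀ (c : {c : ℕ × ℕ // c ∈ F n P}) (ξ : ℕ) (hξ : ξ < k),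
    (T c = k - ξ ↔
      (ht n (C ⟨ξ, by omega⟩) (cellX n c.1) ≤ cellY n c.1 ∧
       cellY n c.1 < ht n (C ⟨ξ + 1, by omega⟩) (cellX n c.1)))

/-- The interval `[P, Q]` is small. -/
def small (n : ℕ) (P Q : Fin n → Bool) : Prop :=
  Q = P ∨ ∃ (S : Finset (Fin n → Bool)) (hS : S.Nonempty),
    (∀ R ∈ S, covers n P R) ∧ ∀ x ≤ n, ht n Q x = S.sup' hS fun R => ht n R x

/-- `lv P`: the minimal height among all valleys of `P`. -/
noncomputable def lv (n : ℕ) (P : Fin n → Bool) : ℤ :=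
  sInf {h : ℤ | ∃ x, valley n P x ∧ ht n P x = h}

/-- `δ(P) = n − 1 − lv(P)`, the degree of `P`. -/
noncomputable def deg (n : ℕ) (P : Fin n → Bool) : ℕ :=
  ((n : ℤ) - 1 - lv n P).toNat

/-- Number of downsteps among the first `x` steps. -/
def D (n : ℕ) (P : Fin n → Bool) : ℕ → ℕ
  | 0 => 0
  | x + 1 => D n P x + if stp n P (x + 1) then 0 else 1

theorem D_up {n : ℕ} {P : Fin n → Bool} {x : ℕ} (h : stp n P (x + 1) = true) :
    D n P (x + 1) = D n P x := by simp [D, h]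

theorem D_down {n : ℕ} {P : Fin n → Bool} {x : ℕ} (h : stp n P (x + 1) = false) :
    D n P (x + 1) = D n P x + 1 := by simp [D, h]

theorem D_succ (n : ℕ) (P : Fin n → Bool) (x : ℕ) :
    (stp n P (x + 1) = true ∧ D n P (x + 1) = D n P x) ∨
    (stp n P (x + 1) = false ∧ D n P (x + 1) = D n P x + 1) := by
  cases h : stp n P (x + 1)
  · right; exact ⟨rfl, D_down h⟩
  · left; exact ⟨rfl, D_up h⟩

theorem stp_big {n : ℕ} {P : Fin n → Bool} {x : ℕ} (h : n < x) : stp n P x = true := by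
  unfold stp; rw [dif_neg]; omega

theorem ht_eq (n : ℕ) (P : Fin n → Bool) (x : ℕ) : ht n P x = x - 2 * (D n P x : ℤ) := by
  induction x with
  | zero => simp [ht, D]
  | succ x ih =>
    unfold ht at *
    rw [Finset.sum_Icc_succ_top (by omega), ih]
    rcases D_succ n P x with ⟨h, h'⟩ | ⟨h, h'⟩ <;> rw [h'] <;> simp [h] <;> ring

theorem D_le_self (n : ℕ) (P : Fin n → Bool) (x : ℕ) : D n P x ≤ x := by
  induction x with
  | zero => simp [D]
  | succ x ih => rcases D_succ n P x with ⟨h, h'⟩ | ⟨h, h'⟩ <;> omega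

theorem D_ext {n : ℕ} {P Q : Fin n → Bool} (h : ∀ x ≤ n, D n P x = D n Q x) : P = Q := by
  funext j
  have h1 := h j (by omega)
  have h2 := h (j + 1) (by omega)
  have e : ∀ R : Fin n → Bool, stp n R (j + 1) = R j := by
    intro R; unfold stp; rw [dif_pos (by omega)]; simp
  rw [← e P, ← e Q]
  rcases D_succ n P j with ⟨a, a'⟩ | ⟨a, a'⟩ <;> rcases D_succ n Q j with ⟨b, b'⟩ | ⟨b, b'⟩ <;>
    first | omega | (rw [a, b])

theorem D_top (n x : ℕ) : D n (pTop n) x = 0 := by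
  induction x with
  | zero => rfl
  | succ x ih =>
    rw [D_up, ih]; unfold stp pTop; split <;> rfl

theorem pLE_iff {n : ℕ} {P Q : Fin n → Bool} : pLE n P Q ↔ ∀ x ≤ n, D n Q x ≤ D n P x := by
  unfold pLE
  refine forall₂_congr fun x _ => ?_
  rw [ht_eq, ht_eq]; omega

theorem pLE_antisymm {n : ℕ} {P Q : Fin n → Bool} (h : pLE n P Q) (h' : pLE n Q P) : P = Q :=
  D_ext fun x hx => le_antisymm (pLE_iff.1 h' x hx) (pLE_iff.1 h x hx)

theorem pLT_iff {n : ℕ} {P Q : Fin n → Bool} : pLT n P Q ↔ pLE n P Q ∧ P ≠ Q := by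
  unfold pLT
  constructor
  · rintro ⟨h, h'⟩; exact ⟨h, fun e => h' (e ▸ fun x _ => le_rfl)⟩
  · rintro ⟨h, h'⟩; exact ⟨h, fun e => h' (pLE_antisymm h e)⟩

/-- A path from a count function. -/
def mkP (n : ℕ) (g : ℕ → ℕ) : Fin n → Bool := fun j => decide (g (j + 1) = g j)

theorem D_mk {n : ℕ} {g : ℕ → ℕ} (h0 : g 0 = 0)
    (hg : ∀ x < n, g (x + 1) = g x ∨ g (x + 1) = g x + 1) :
    ∀ x ≤ n, D n (mkP n g) x = g x := by
  intro x
  induction x with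
  | zero => intro _; simp [D, h0]
  | succ x ih =>
    intro hx
    have e : stp n (mkP n g) (x + 1) = decide (g (x + 1) = g x) := by
      unfold stp; rw [dif_pos (by omega)]; simp [mkP]
    rcases hg x (by omega) with h | h
    · rw [D_up (by rw [e]; simpa using h), ih (by omega), h]
    · rw [D_down (by rw [e]; simp [h]), ih (by omega), h]

theorem valley_iff {n : ℕ} {P : Fin n → Bool} {x : ℕ} : valley n P x ↔
    1 ≤ x ∧ x ≤ n ∧ D n P x = D n P (x - 1) + 1 ∧ (x < n → D n P (x + 1) = D n P x) := by
  unfold valley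
  constructor
  · rintro ⟨a, b, c, d⟩
    refine ⟨a, b, ?_, ?_⟩
    · obtain ⟨y, rfl⟩ : ∃ y, x = y + 1 := ⟨x - 1, by omega⟩
      exact D_down c
    · intro h; exact D_up (d.resolve_left (by omega))
  · rintro ⟨a, b, c, d⟩
    refine ⟨a, b, ?_, ?_⟩
    · obtain ⟨y, rfl⟩ : ∃ y, x = y + 1 := ⟨x - 1, by omega⟩
      rcases D_succ n P y with ⟨e, e'⟩ | ⟨e, e'⟩
      · simp at c; omega
      · exact e
    · by_cases hx : x = n
      · exact Or.inl hx
      · right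
        rcases D_succ n P x with ⟨e, e'⟩ | ⟨e, e'⟩
        · exact e
        · have := d (by omega); omega

theorem exists_valley {n : ℕ} {P Q : Fin n → Bool} (h : pLE n P Q) (hne : P ≠ Q) :
    ∃ x, valley n P x ∧ D n Q x < D n P x := by
  have hle := pLE_iff.1 h
  have hex : ∃ m : ℕ, ∃ x, x ≤ n ∧ D n Q x < D n P x ∧ m = x + 2 * (n - D n P x) := by
    by_contra hc
    push Not at hc
    refine hne (D_ext fun x hx => le_antisymm ?_ (hle x hx))
    by_contra hlt
    exact hc _ x hx (by omega) rfl
  classical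
  obtain ⟨x, hx, hlt, hm⟩ := Nat.find_spec hex
  have hmin := fun m (hm : m < Nat.find hex) => Nat.find_min hex hm
  refine ⟨x, valley_iff.2 ⟨?_, hx, ?_, ?_⟩, hlt⟩
  · rcases Nat.eq_zero_or_pos x with h0 | h0
    · subst h0; simp [D] at hlt
    · exact h0
  · obtain ⟨y, rfl⟩ : ∃ y, x = y + 1 := by
      rcases Nat.eq_zero_or_pos x with h0 | h0
      · subst h0; simp [D] at hlt
      · exact ⟨x - 1, by omega⟩
    simp only [Nat.add_sub_cancel]
    rcases D_succ n P y with ⟨e, e'⟩ | ⟨e, e'⟩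
    · exfalso
      refine hmin (y + 2 * (n - D n P y)) (by omega) ⟨y, by omega, ?_, rfl⟩
      rcases D_succ n Q y with ⟨b, b'⟩ | ⟨b, b'⟩ <;> omega
    · exact e'
  · intro hxn
    rcases D_succ n P x with ⟨e, e'⟩ | ⟨e, e'⟩
    · exact e'
    · exfalso
      have := D_le_self n P (x+1)
      refine hmin (x + 1 + 2 * (n - D n P (x + 1))) (by omega) ⟨x + 1, by omega, ?_, rfl⟩
      rcases D_succ n Q x with ⟨b, b'⟩ | ⟨b, b'⟩ <;> omega

/-- Raise the valley at `x`. -/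
def raise (n : ℕ) (P : Fin n → Bool) (x : ℕ) : Fin n → Bool :=
  mkP n fun y => D n P y - if y = x then 1 else 0

theorem D_raise {n : ℕ} {P : Fin n → Bool} {x : ℕ} (hv : valley n P x) :
    ∀ y ≤ n, D n (raise n P x) y = D n P y - if y = x then 1 else 0 := by
  obtain ⟨a, b, c, d⟩ := valley_iff.1 hv
  apply D_mk
  · simp [D]
  · intro y hy
    have h1 := D_succ n P y
    by_cases e : y + 1 = x
    · subst e
      simp at c ⊢; omega
    · by_cases e' : y = x
      · subst e'
        have := d hy
        simp; omega
      · simp [e, e']; omega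

theorem covers_iff {n : ℕ} {P R : Fin n → Bool} :
    covers n P R ↔ ∃ x, valley n P x ∧ R = raise n P x := by
  have key : ∀ x, valley n P x → pLT n P (raise n P x) := by
    intro x hv
    refine pLT_iff.2 ⟨pLE_iff.2 fun y hy => ?_, fun e => ?_⟩
    · rw [D_raise hv y hy]; omega
    · have := D_raise hv x hv.2.1
      rw [← e] at this
      have := (valley_iff.1 hv).2.2.1
      simp at *; omega
  constructor
  · rintro ⟨h, h'⟩
    obtain ⟨hle, hne⟩ := pLT_iff.1 h
    obtain ⟨x, hv, hx⟩ := exists_valley hle hne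
    refine ⟨x, hv, ?_⟩
    have h1 := h' _ (key x hv)
    rw [pLT_iff] at h1
    by_contra hc
    refine h1 ⟨pLE_iff.2 fun y hy => ?_, Ne.symm hc⟩
    rw [D_raise hv y hy]
    have := pLE_iff.1 hle y hy
    split
    · subst_vars; omega
    · omega
  · rintro ⟨x, hv, rfl⟩
    refine ⟨key x hv, fun R h1 h2 => ?_⟩
    rw [pLT_iff, pLE_iff] at h1 h2
    by_cases hx : D n R x = D n P x
    · refine h1.2 (D_ext fun y hy => ?_)
      have a := h1.1 y hy
      have b := h2.1 y hy
      rw [D_raise hv y hy] at b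
      split at b
      · subst_vars; omega
      · omega
    · refine h2.2 (D_ext fun y hy => ?_)
      have a := h1.1 y hy
      have b := h2.1 y hy
      rw [D_raise hv y hy] at b ⊢
      split at b
      · subst_vars; simp; omega
      · simp [*]; omega

theorem smallP_iff {n : ℕ} {P Q : Fin n → Bool} : small n P Q ↔
    ∀ x ≤ n, D n Q x = D n P x ∨ (D n Q x + 1 = D n P x ∧ valley n P x) := by
  classical
  constructor
  · rintro (rfl | ⟨S, hS, hc, hs⟩)
    · intro x _; left; rfl
    · intro x hx
      obtain ⟨R, hR, e⟩ := Finset.exists_mem_eq_sup' hS fun R => ht n R x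
      have h1 := hs x hx
      rw [e] at h1
      obtain ⟨y, hv, rfl⟩ := covers_iff.1 (hc R hR)
      rw [ht_eq, ht_eq, D_raise hv x hx] at h1
      by_cases hxy : x = y
      · subst hxy
        have := (valley_iff.1 hv).2.2.1
        right
        refine ⟨?_, hv⟩
        simp at h1; omega
      · left; simp [hxy] at h1; omega
  · intro h
    by_cases hne : P = Q
    · left; exact hne.symm
    right
    have hle : pLE n P Q := pLE_iff.2 fun x hx => by have := h x hx; omega
    have hmem : ∀ R, R ∈ ((Finset.range (n + 1)).filter
      fun x => valley n P x ∧ D n Q x + 1 = D n P x).image (raise n P) ↔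
      ∃ x, valley n P x ∧ D n Q x + 1 = D n P x ∧ raise n P x = R := by
      intro R
      simp only [Finset.mem_image, Finset.mem_filter, Finset.mem_range]
      constructor
      · rintro ⟨x, ⟨_, a, b⟩, c⟩; exact ⟨x, a, b, c⟩
      · rintro ⟨x, a, b, c⟩; exact ⟨x, ⟨by have := a.2.1; omega, a, b⟩, c⟩
    have hS : (((Finset.range (n + 1)).filter
      fun x => valley n P x ∧ D n Q x + 1 = D n P x).image (raise n P)).Nonempty := by
      obtain ⟨x, hv, hx⟩ := exists_valley hle hne
      refine ⟨raise n P x, (hmem _).2 ⟨x, hv, ?_, rfl⟩⟩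
      have := h x hv.2.1; omega
    refine ⟨_, hS, ?_, ?_⟩
    · intro R hR
      obtain ⟨x, a, b, c⟩ := (hmem R).1 hR
      exact covers_iff.2 ⟨x, a, c.symm⟩
    · intro y hy
      apply le_antisymm
      · rcases h y hy with e | ⟨e, hv⟩
        · obtain ⟨R, hR⟩ := hS
          refine le_trans ?_ (Finset.le_sup' (fun R => ht n R y) hR)
          obtain ⟨x, a, b, rfl⟩ := (hmem R).1 hR
          simp only [ht_eq, D_raise a y hy]
          omega
        · refine le_trans ?_ (Finset.le_sup' (fun R => ht n R y) ((hmem _).2 ⟨y, hv, e, rfl⟩))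
          simp only [ht_eq, D_raise hv y hy]
          simp; omega
      · apply Finset.sup'_le
        intro R hR
        obtain ⟨x, a, b, rfl⟩ := (hmem R).1 hR
        simp only [ht_eq, D_raise a y hy]
        have := h y hy
        split
        · subst_vars; omega
        · omega

theorem dpos_strictMono (n : ℕ) (P : Fin n → Bool) : StrictMono (dpos n P) := by
  intro a b h
  unfold dpos
  have := ((dsteps n P).orderIsoOfFin rfl).strictMono h
  exact this

theorem D_card (n : ℕ) (P : Fin n → Bool) (x : ℕ) :
    D n P x = ((dsteps n P).filter fun j : Fin n => (j : ℕ) < x).card := by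
  induction x with
  | zero => simp [D]
  | succ x ih =>
    by_cases hx : x < n
    · have e : stp n P (x + 1) = P ⟨x, hx⟩ := by
        unfold stp; rw [dif_pos (by omega)]; simp
      rcases D_succ n P x with ⟨a, a'⟩ | ⟨a, a'⟩
      · rw [a', ih]
        congr 1
        ext j
        simp only [dsteps, Finset.mem_filter, Finset.mem_univ, true_and]
        refine and_congr_right fun hj => ?_
        have : (j : ℕ) ≠ x := by
          rintro rfl
          rw [e] at a; simp at a; rw [a] at hj; simp at hj
        omega
      · rw [a', ih, ← Finset.card_insert_of_notMem (a := (⟨x, hx⟩ : Fin n)) (by simp)]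
        congr 1
        ext j
        simp only [dsteps, Finset.mem_filter, Finset.mem_univ, true_and, Finset.mem_insert, Fin.ext_iff]
        constructor
        · rintro (h | h)
          · have : j = ⟨x, hx⟩ := Fin.ext h
            subst this
            exact ⟨by rw [← e, a], by simp⟩
          · exact ⟨h.1, by omega⟩
        · rintro ⟨h, h'⟩
          by_cases h2 : (j : ℕ) = x
          · left; exact h2
          · right; exact ⟨h, by omega⟩
    · rw [D_up (stp_big (by omega)), ih]
      congr 1
      ext j
      simp only [Finset.mem_filter]
      refine and_congr_right fun hj => ?_
      omega

theorem D_card' (n : ℕ) (P : Fin n → Bool) (x : ℕ) :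
    D n P x = (Finset.univ.filter fun i : Fin (nd n P) => dpos n P i < x).card := by
  rw [D_card]
  symm
  refine Finset.card_bij (fun i _ => (((dsteps n P).orderIsoOfFin rfl i : {x // x ∈ dsteps n P}) : Fin n)) ?_ ?_ ?_
  · intro i hi
    simp only [Finset.mem_filter, Finset.mem_univ, true_and] at hi
    exact Finset.mem_filter.2 ⟨((dsteps n P).orderIsoOfFin rfl i).2, hi⟩
  · intro a _ b _ h
    exact ((dsteps n P).orderIsoOfFin rfl).injective (Subtype.ext h)
  · intro b hb
    obtain ⟨h1, h2⟩ := Finset.mem_filter.1 hb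
    refine ⟨((dsteps n P).orderIsoOfFin rfl).symm ⟨b, h1⟩, ?_, by simp⟩
    refine Finset.mem_filter.2 ⟨Finset.mem_univ _, ?_⟩
    unfold dpos
    rw [OrderIso.apply_symm_apply]
    exact h2

theorem dpos_lt_iff (n : ℕ) (P : Fin n → Bool) (x : ℕ) (i : Fin (nd n P)) :
    dpos n P i < x ↔ (i : ℕ) < D n P x := by
  rw [D_card']
  constructor
  · intro h
    have : (Finset.Iic i).card ≤ (Finset.univ.filter fun i : Fin (nd n P) => dpos n P i < x).card := by
      apply Finset.card_le_card
      intro j hj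
      simp only [Finset.mem_filter, Finset.mem_univ, true_and]
      exact lt_of_le_of_lt ((dpos_strictMono n P).monotone (Finset.mem_Iic.1 hj)) h
    rw [Fin.card_Iic] at this; omega
  · intro h
    by_contra hc
    have : (Finset.univ.filter fun i : Fin (nd n P) => dpos n P i < x).card ≤ (Finset.Iio i).card := by
      apply Finset.card_le_card
      intro j hj
      simp only [Finset.mem_filter, Finset.mem_univ, true_and] at hj
      refine Finset.mem_Iio.2 ((dpos_strictMono n P).lt_iff_lt.1 (by omega))
    rw [Fin.card_Iio] at this; omega

theorem mem_F {n : ℕ} {P : Fin n → Bool} {c : ℕ × ℕ} :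
    c ∈ F n P ↔ 1 ≤ c.1 ∧ c.1 ≤ c.2 ∧ c.1 ≤ D n P (n + c.1 - c.2) := by
  have hb : ∀ i, dpos n P i < n := fun i => by unfold dpos; exact Fin.is_lt _
  obtain ⟨a, b⟩ := c
  simp only [F, Set.mem_ofPred_eq, lam]
  constructor
  · rintro ⟨i, rfl, h1, h2⟩
    refine ⟨by omega, h1, ?_⟩
    have := hb i
    exact (dpos_lt_iff n P _ i).1 (by omega)
  · rintro ⟨h1, h2, h3⟩
    have hnd : D n P (n + a - b) ≤ nd n P := by
      rw [D_card]; exact Finset.card_le_card (Finset.filter_subset _ _)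
    refine ⟨⟨a - 1, by omega⟩, by simp; omega, by simp; omega, ?_⟩
    have := (dpos_lt_iff n P (n + a - b) ⟨a - 1, by omega⟩).2 (by simp; omega)
    have := D_le_self n P (n + a - b)
    simp only
    omega

theorem mem_F' {n : ℕ} {P : Fin n → Bool} {i x : ℕ} (hi : 1 ≤ i) (hx : x ≤ n) (h : i ≤ D n P x) :
    (i, n + i - x) ∈ F n P := by
  rw [mem_F]
  refine ⟨hi, by simp; omega, ?_⟩
  have : n + i - (n + i - x) = x := by omega
  simp only [this]; exact h

/-- Entry of the tableau at the lattice cell `(i, x)`. -/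
noncomputable def ent (n : ℕ) (P : Fin n → Bool) (T : {c : ℕ × ℕ // c ∈ F n P} → ℕ) (i x : ℕ) : ℕ :=
  open Classical in if h : (i, n + i - x) ∈ F n P then T ⟨_, h⟩ else 0

theorem ent_eq {n : ℕ} {P : Fin n → Bool} (T : {c : ℕ × ℕ // c ∈ F n P} → ℕ) {i x : ℕ}
    (h : (i, n + i - x) ∈ F n P) : ent n P T i x = T ⟨_, h⟩ := by
  unfold ent; rw [dif_pos h]

theorem ent_cell {n : ℕ} {P : Fin n → Bool} (T : {c : ℕ × ℕ // c ∈ F n P} → ℕ)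
    (c : {c : ℕ × ℕ // c ∈ F n P}) : ent n P T c.1.1 (n + c.1.1 - c.1.2) = T c := by
  obtain ⟨⟨a, b⟩, h⟩ := c
  have h' := mem_F.1 h
  simp only at h' ⊢
  have hD := D_le_self n P (n + a - b)
  have e : n + a - (n + a - b) = b := by omega
  have : (a, n + a - (n + a - b)) ∈ F n P := by rw [e]; exact h
  rw [ent_eq T this]
  congr 1
  apply Subtype.ext
  simp only [e]

theorem ent_row {n : ℕ} {P : Fin n → Bool} {T : {c : ℕ × ℕ // c ∈ F n P} → ℕ}
    (hT : isStrictTab n P T) {i x : ℕ} (hi : 1 ≤ i) (hx : x < n) (h : i ≤ D n P x) :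
    ent n P T i (x + 1) < ent n P T i x := by
  have h1 : i ≤ D n P (x + 1) := by have := D_succ n P x; omega
  rw [ent_eq T (mem_F' hi hx.le h), ent_eq T (mem_F' hi hx h1)]
  apply hT.1
  · rfl
  · simp; omega

theorem ent_col {n : ℕ} {P : Fin n → Bool} {T : {c : ℕ × ℕ // c ∈ F n P} → ℕ}
    (hT : isStrictTab n P T) {i x : ℕ} (hi : 1 ≤ i) (hx : x < n) (h : i + 1 ≤ D n P (x + 1)) :
    ent n P T i x < ent n P T (i + 1) (x + 1) := by
  have h1 : i ≤ D n P x := by have := D_succ n P x; omega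
  rw [ent_eq T (mem_F' hi hx.le h1), ent_eq T (mem_F' (by omega) hx h)]
  apply hT.2
  · rfl
  · simp; omega

theorem ent_diag {n : ℕ} {P : Fin n → Bool} {T : {c : ℕ × ℕ // c ∈ F n P} → ℕ}
    (hT : isStrictTab n P T) {i x : ℕ} (hi : 1 ≤ i) (hx : x ≤ n) (h : i + 1 ≤ D n P x) :
    ent n P T i x < ent n P T (i + 1) x := by
  obtain ⟨y, rfl⟩ : ∃ y, x = y + 1 := by
    rcases Nat.eq_zero_or_pos x with h0 | h0
    · subst h0; simp [D] at h
    · exact ⟨x - 1, by omega⟩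
  have h1 : i ≤ D n P y := by have := D_succ n P y; omega
  exact (ent_row hT hi hx h1).trans (ent_col hT hi hx h)

theorem ent_onto {n : ℕ} {P : Fin n → Bool} {T : {c : ℕ × ℕ // c ∈ F n P} → ℕ}
    (hT : isStrictTab n P T) (h0 : ∀ c, 0 < T c) : ∀ r i x : ℕ, 1 ≤ i → x ≤ n → i ≤ D n P x →
    n - x + 2 * i - 1 = r → r ≤ ent n P T i x ∧ (ent n P T i x ≤ r →
      ∀ s, 1 ≤ s → s ≤ r → ∃ i x, 1 ≤ i ∧ x ≤ n ∧ i ≤ D n P x ∧ ent n P T i x = s) := by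
  intro r
  induction r with
  | zero => intro i x hi hx h hr; omega
  | succ r ih =>
    intro i x hi hx h hr
    have fin : ∀ i' x', 1 ≤ i' → x' ≤ n → i' ≤ D n P x' → n - x' + 2 * i' - 1 = r →
        ent n P T i' x' < ent n P T i x → r + 1 ≤ ent n P T i x ∧ (ent n P T i x ≤ r + 1 →
      ∀ s, 1 ≤ s → s ≤ r + 1 → ∃ i x, 1 ≤ i ∧ x ≤ n ∧ i ≤ D n P x ∧ ent n P T i x = s) := by
      intro i' x' a b c d e
      obtain ⟨p, q⟩ := ih i' x' a b c d
      refine ⟨by omega, fun hle s hs1 hs2 => ?_⟩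
      by_cases hs : s = r + 1
      · exact ⟨i, x, hi, hx, h, by omega⟩
      · exact q (by omega) s hs1 (by omega)
    obtain ⟨y, rfl⟩ : ∃ y, x = y + 1 := by
      rcases Nat.eq_zero_or_pos x with h0 | h0
      · subst h0; simp [D] at h; omega
      · exact ⟨x - 1, by omega⟩
    by_cases hi2 : i = 1
    · subst hi2
      by_cases hxn : y + 1 = n
      · have hr0 : r = 0 := by omega
        subst hr0
        have : 0 < ent n P T 1 (y + 1) := by
          rw [ent_eq T (mem_F' hi hx h)]; exact h0 _
        refine ⟨by omega, fun hle s hs1 hs2 => ⟨1, y + 1, hi, hx, h, by omega⟩⟩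
      · refine fin 1 (y + 1 + 1) le_rfl (by omega) ?_ (by omega) ?_
        · have := D_succ n P (y + 1); omega
        · exact ent_row hT hi (by omega) h
    · obtain ⟨j, rfl⟩ : ∃ j, i = j + 1 := ⟨i - 1, by omega⟩
      refine fin j y (by omega) (by omega) ?_ (by omega) ?_
      · have := D_succ n P y; omega
      · exact ent_col hT (by omega) (by omega) h

theorem deg_spec {n : ℕ} {P : Fin n → Bool} (hP : P ≠ pTop n) :
    ∃ i x, 1 ≤ i ∧ x ≤ n ∧ i ≤ D n P x ∧ n - x + 2 * i - 1 = deg n P := by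
  have hne : {h : ℤ | ∃ x, valley n P x ∧ ht n P x = h}.Nonempty := by
    obtain ⟨x, hv, _⟩ := exists_valley (P := P) (Q := pTop n)
      (pLE_iff.2 fun x _ => by rw [D_top]; omega) hP
    exact ⟨_, x, hv, rfl⟩
  have hb : BddBelow {h : ℤ | ∃ x, valley n P x ∧ ht n P x = h} := by
    refine ⟨-(n : ℤ), ?_⟩
    rintro h ⟨x, hv, rfl⟩
    rw [ht_eq]
    have := D_le_self n P x
    have := hv.2.1
    omega
  obtain ⟨x, hv, hx⟩ := Int.csInf_mem hne hb
  have hv' := valley_iff.1 hv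
  refine ⟨D n P x, x, by omega, by omega, le_rfl, ?_⟩
  unfold deg lv
  rw [← hx, ht_eq]
  omega

/-- Count function of the sublevel shape `T ≤ s`. -/
noncomputable def G (n : ℕ) (P : Fin n → Bool) (T : {c : ℕ × ℕ // c ∈ F n P} → ℕ) (s x : ℕ) : ℕ :=
  open Classical in Nat.findGreatest (fun i => ent n P T i x ≤ s) (D n P x)

theorem G_le (n : ℕ) (P : Fin n → Bool) (T : {c : ℕ × ℕ // c ∈ F n P} → ℕ) (s x : ℕ) :
    G n P T s x ≤ D n P x := by unfold G; exact Nat.findGreatest_le _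

theorem ent_zero (n : ℕ) (P : Fin n → Bool) (T : {c : ℕ × ℕ // c ∈ F n P} → ℕ) (x : ℕ) :
    ent n P T 0 x = 0 := by
  unfold ent; rw [dif_neg]; rw [mem_F]; simp

theorem le_G {n : ℕ} {P : Fin n → Bool} {T : {c : ℕ × ℕ // c ∈ F n P} → ℕ}
    (hT : isStrictTab n P T) {s x i : ℕ} (hx : x ≤ n) (hi : i ≤ D n P x) :
    i ≤ G n P T s x ↔ ent n P T i x ≤ s := by
  constructor
  · intro h
    have h1 : ent n P T (G n P T s x) x ≤ s := by
      unfold G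
      exact Nat.findGreatest_spec (P := fun i => ent n P T i x ≤ s) (Nat.zero_le _)
        (by rw [ent_zero]; omega)
    have mono : ∀ d, i + d ≤ D n P x → ent n P T i x ≤ ent n P T (i + d) x := by
      intro d
      induction d with
      | zero => intro _; exact le_rfl
      | succ d ih =>
        intro hd
        refine (ih (by omega)).trans ?_
        rcases Nat.eq_zero_or_pos (i + d) with h0 | h0
        · rw [h0, ent_zero]; omega
        · exact (ent_diag hT h0 hx hd).le
    obtain ⟨d, hd⟩ := Nat.exists_eq_add_of_le h
    have := mono d (by rw [← hd]; exact G_le ..)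
    rw [← hd] at this
    exact this.trans h1
  · intro h
    unfold G
    exact Nat.le_findGreatest hi h

theorem G_zero (n : ℕ) (P : Fin n → Bool) (T : {c : ℕ × ℕ // c ∈ F n P} → ℕ) (s : ℕ) :
    G n P T s 0 = 0 := by have := G_le n P T s 0; simpa [D] using this

theorem G_succ {n : ℕ} {P : Fin n → Bool} {T : {c : ℕ × ℕ // c ∈ F n P} → ℕ}
    (hT : isStrictTab n P T) (s x : ℕ) (hx : x < n) :
    G n P T s (x + 1) = G n P T s x ∨ G n P T s (x + 1) = G n P T s x + 1 := by
  have hD := D_succ n P x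
  have g1 := G_le n P T s x
  have g2 := G_le n P T s (x + 1)
  have a : G n P T s x ≤ G n P T s (x + 1) := by
    rcases Nat.eq_zero_or_pos (G n P T s x) with h0 | h0
    · omega
    · rw [le_G hT (x := x + 1) hx (by omega)]
      have := ent_row hT h0 hx g1
      have := (le_G hT (s := s) hx.le g1).1 le_rfl
      omega
  have b : G n P T s (x + 1) ≤ G n P T s x + 1 := by
    by_contra hc
    obtain ⟨i, hi⟩ : ∃ i, G n P T s (x + 1) = i + 1 := ⟨G n P T s (x + 1) - 1, by omega⟩
    have h1 := (le_G hT (s := s) (x := x + 1) hx g2).1 le_rfl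
    rw [hi] at h1
    have h2 := ent_col hT (i := i) (by omega) hx (by omega)
    have h3 := (le_G hT (s := s) hx.le (i := i) (by omega)).2 (by omega)
    omega
  omega

theorem D_G {n : ℕ} {P : Fin n → Bool} {T : {c : ℕ × ℕ // c ∈ F n P} → ℕ}
    (hT : isStrictTab n P T) (s : ℕ) : ∀ x ≤ n, D n (mkP n (G n P T s)) x = G n P T s x :=
  D_mk (G_zero n P T s) (G_succ hT s)

theorem G_step {n : ℕ} {P : Fin n → Bool} {T : {c : ℕ × ℕ // c ∈ F n P} → ℕ}
    (hT : isStrictTab n P T) (s : ℕ) : small n (mkP n (G n P T (s + 1))) (mkP n (G n P T s)) := by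
  rw [smallP_iff]
  intro x hx
  rw [D_G hT _ x hx, D_G hT _ x hx]
  have g1 := G_le n P T s x
  have g2 := G_le n P T (s + 1) x
  by_cases hE : G n P T s x = G n P T (s + 1) x
  · left; exact hE
  right
  have hle : G n P T s x ≤ G n P T (s + 1) x := by
    rw [le_G hT hx g1]
    have := (le_G hT (s := s) hx g1).1 le_rfl
    omega
  obtain ⟨i, hi⟩ : ∃ i, G n P T (s + 1) x = i + 1 := ⟨G n P T (s + 1) x - 1, by omega⟩
  have t1 : ent n P T (i + 1) x ≤ s + 1 := by
    rw [← hi]; exact (le_G hT (s := s + 1) hx g2).1 le_rfl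
  have t2 : ¬ ent n P T (i + 1) x ≤ s := by
    rw [← le_G hT hx (by omega)]; omega
  have t3 : ent n P T i x ≤ s := by
    rcases Nat.eq_zero_or_pos i with h0 | h0
    · rw [h0, ent_zero]; omega
    · have := ent_diag hT h0 hx (by omega); omega
  have t4 := (le_G hT hx (by omega)).2 t3
  refine ⟨by omega, valley_iff.2 ?_⟩
  have hx1 : 1 ≤ x := by
    rcases Nat.eq_zero_or_pos x with h0 | h0
    · subst h0; rw [G_zero] at hi; omega
    · exact h0
  refine ⟨hx1, hx, ?_, ?_⟩
  · obtain ⟨y, rfl⟩ : ∃ y, x = y + 1 := ⟨x - 1, by omega⟩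
    simp only [Nat.add_sub_cancel]
    rw [D_G hT _ _ hx, D_G hT _ _ (by omega)]
    rcases G_succ hT (s + 1) y (by omega) with h | h
    · exfalso
      have hD := G_le n P T (s + 1) y
      have a := ent_row hT (i := i + 1) (x := y) (by omega) (by omega) (by omega)
      have b := (le_G hT (s := s + 1) (x := y) (i := i + 1) (by omega) (by omega)).1 (by omega)
      omega
    · exact h
  · intro hxn
    rw [D_G hT _ _ hx, D_G hT _ _ (by omega)]
    rcases G_succ hT (s + 1) x hxn with h | h
    · exact h
    · exfalso
      have hD := G_le n P T (s + 1) (x + 1)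
      have a := ent_col hT (i := i + 1) (x := x) (by omega) (by omega) (by omega)
      have b := (le_G hT (s := s + 1) (x := x + 1) (i := i + 1 + 1) (by omega) (by omega)).1 (by omega)
      omega

theorem pLE_of_small {n : ℕ} {P Q : Fin n → Bool} (h : small n P Q) : pLE n P Q := by
  rw [pLE_iff]; intro x hx; have := smallP_iff.1 h x hx; omega

/-- Extension of a chain to all natural indices. -/
def extC (n k : ℕ) (C : Fin (k + 1) → Fin n → Bool) (m : ℕ) : Fin n → Bool :=
  C ⟨min m k, by omega⟩

def chainP (n k : ℕ) (P : Fin n → Bool) (C : Fin (k + 1) → Fin n → Bool) : Prop :=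
  C 0 = P ∧ C (Fin.last k) = pTop n ∧
        ∀ i : Fin k, pLT n (C i.castSucc) (C i.succ) ∧ small n (C i.castSucc) (C i.succ)

theorem ext_step {n k : ℕ} {P : Fin n → Bool} {C : Fin (k + 1) → Fin n → Bool}
    (h : chainP n k P C) (m : ℕ) : small n (extC n k C m) (extC n k C (m + 1)) := by
  by_cases hm : m < k
  · have := (h.2.2 ⟨m, hm⟩).2
    unfold extC
    convert this using 2
    · ext; simp; omega
    · ext; simp; omega
  · left; unfold extC; congr 2; omega

theorem ext_anti {n k : ℕ} {P : Fin n → Bool} {C : Fin (k + 1) → Fin n → Bool}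
    (h : chainP n k P C) (x : ℕ) (hx : x ≤ n) : Antitone fun m => D n (extC n k C m) x :=
  antitone_nat_of_succ_le fun m => pLE_iff.1 (pLE_of_small (ext_step h m)) x hx

/-- Index at which the cell `(i, x)` disappears. -/
noncomputable def rem (n k : ℕ) (C : Fin (k + 1) → Fin n → Bool) (i x : ℕ) : ℕ :=
  sInf {m | D n (extC n k C m) x < i}

theorem ext_zero {n k : ℕ} {P : Fin n → Bool} {C : Fin (k + 1) → Fin n → Bool}
    (h : chainP n k P C) : extC n k C 0 = P := by
  rw [← h.1]; unfold extC; congr 1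

theorem ext_last {n k : ℕ} {P : Fin n → Bool} {C : Fin (k + 1) → Fin n → Bool}
    (h : chainP n k P C) : extC n k C k = pTop n := by
  rw [← h.2.1]; unfold extC; congr 1; ext; simp

theorem rem_le_iff {n k : ℕ} {P : Fin n → Bool} {C : Fin (k + 1) → Fin n → Bool}
    (h : chainP n k P C) {i x : ℕ} (hi : 1 ≤ i) (hx : x ≤ n) (m : ℕ) :
    rem n k C i x ≤ m ↔ D n (extC n k C m) x < i := by
  have hk : k ∈ {m | D n (extC n k C m) x < i} := by
    show D n (extC n k C k) x < i
    rw [ext_last h, D_top]; omega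
  constructor
  · intro hm
    have h1 : D n (extC n k C (rem n k C i x)) x < i := Nat.sInf_mem (s := {m | D n (extC n k C m) x < i}) ⟨k, hk⟩
    exact lt_of_le_of_lt (ext_anti h x hx hm) h1
  · intro hm; exact Nat.sInf_le hm

theorem rem_le {n k : ℕ} {P : Fin n → Bool} {C : Fin (k + 1) → Fin n → Bool}
    (h : chainP n k P C) {i x : ℕ} (hi : 1 ≤ i) (hx : x ≤ n) : rem n k C i x ≤ k := by
  rw [rem_le_iff h hi hx, ext_last h, D_top]; omega

theorem rem_pos {n k : ℕ} {P : Fin n → Bool} {C : Fin (k + 1) → Fin n → Bool}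
    (h : chainP n k P C) {i x : ℕ} (hi : 1 ≤ i) (hx : x ≤ n) (hD : i ≤ D n P x) :
    1 ≤ rem n k C i x := by
  by_contra hc
  have := (rem_le_iff h hi hx 0).1 (by omega)
  rw [ext_zero h] at this; omega

theorem rem_spec {n k : ℕ} {P : Fin n → Bool} {C : Fin (k + 1) → Fin n → Bool}
    (h : chainP n k P C) {i x : ℕ} (hi : 1 ≤ i) (hx : x ≤ n) (hD : i ≤ D n P x) :
    ∃ m, rem n k C i x = m + 1 ∧ D n (extC n k C m) x = i ∧ valley n (extC n k C m) x := by
  have h1 := rem_pos h hi hx hD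
  obtain ⟨m, hm⟩ : ∃ m, rem n k C i x = m + 1 := ⟨rem n k C i x - 1, by omega⟩
  have a := (rem_le_iff h hi hx (m + 1)).1 (by omega)
  have b := mt (rem_le_iff h hi hx m).2 (by omega)
  have c := smallP_iff.1 (ext_step h m) x hx
  rcases c with c | ⟨c, hv⟩
  · omega
  · exact ⟨m, hm, by omega, hv⟩

theorem rem_row {n k : ℕ} {P : Fin n → Bool} {C : Fin (k + 1) → Fin n → Bool}
    (h : chainP n k P C) {i x : ℕ} (hi : 1 ≤ i) (hx : x < n) (hD : i ≤ D n P x) :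
    rem n k C i x < rem n k C i (x + 1) := by
  obtain ⟨m, hm, hd, hv⟩ := rem_spec h hi hx.le hD
  rw [hm]
  by_contra hc
  have a := (rem_le_iff h hi (x := x + 1) hx (m + 1)).1 (by omega)
  have b := (valley_iff.1 hv).2.2.2 hx
  rcases smallP_iff.1 (ext_step h m) (x + 1) hx with c | ⟨c, hv'⟩
  · omega
  · have := (valley_iff.1 hv').2.2.1
    simp at this
    omega

theorem rem_col {n k : ℕ} {P : Fin n → Bool} {C : Fin (k + 1) → Fin n → Bool}
    (h : chainP n k P C) {i x : ℕ} (hi : 1 ≤ i) (hx : x < n) (hD : i + 1 ≤ D n P (x + 1)) :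
    rem n k C (i + 1) (x + 1) < rem n k C i x := by
  obtain ⟨m, hm, hd, hv⟩ := rem_spec h (i := i + 1) (x := x + 1) (by omega) hx hD
  rw [hm]
  by_contra hc
  have a := (rem_le_iff h hi hx.le (m + 1)).1 (by omega)
  have b := (valley_iff.1 hv).2.2.1
  simp at b
  rcases smallP_iff.1 (ext_step h m) x hx.le with c | ⟨c, hv'⟩
  · omega
  · have := (valley_iff.1 hv').2.2.2 hx
    omega

def tabP (n k : ℕ) (P : Fin n → Bool) (T : {c : ℕ × ℕ // c ∈ F n P} → ℕ) : Prop :=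
  (∀ c, 0 < T c) ∧ isStrictTab n P T ∧ (∀ c, T c ≤ k) ∧ (∃ c, T c = k)

noncomputable def toT (n k : ℕ) (P : Fin n → Bool) (C : Fin (k + 1) → Fin n → Bool) :
    {c : ℕ × ℕ // c ∈ F n P} → ℕ := fun c => k + 1 - rem n k C c.1.1 (n + c.1.1 - c.1.2)

theorem toT_tab {n k : ℕ} {P : Fin n → Bool} (hP : P ≠ pTop n) {C : Fin (k + 1) → Fin n → Bool}
    (h : chainP n k P C) : tabP n k P (toT n k P C) := by
  have hc : ∀ c : {c : ℕ × ℕ // c ∈ F n P}, 1 ≤ rem n k C c.1.1 (n + c.1.1 - c.1.2) ∧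
      rem n k C c.1.1 (n + c.1.1 - c.1.2) ≤ k := by
    rintro ⟨c, hc⟩
    have := mem_F.1 hc
    exact ⟨rem_pos h this.1 (by simp; omega) this.2.2, rem_le h this.1 (by simp; omega)⟩
  refine ⟨fun c => ?_, ⟨?_, ?_⟩, fun c => ?_, ?_⟩
  · have := hc c; unfold toT; omega
  · intro c c' e1 e2
    have h1 := hc c
    have h2 := hc c'
    have m1 := mem_F.1 c.2
    have m2 := mem_F.1 c'.2
    have hD := D_le_self n P (n + c'.1.1 - c'.1.2)
    have := rem_row h m2.1 (x := n + c'.1.1 - c'.1.2) (by omega) m2.2.2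
    have e : n + c'.1.1 - c'.1.2 + 1 = n + c.1.1 - c.1.2 := by omega
    rw [e] at this
    have e3 : rem n k C c'.1.1 (n + c.1.1 - c.1.2) = rem n k C c.1.1 (n + c.1.1 - c.1.2) := by rw [e1]
    unfold toT
    omega
  · intro c c' e1 e2
    have h1 := hc c
    have h2 := hc c'
    have m1 := mem_F.1 c.2
    have m2 := mem_F.1 c'.2
    have hD := D_le_self n P (n + c.1.1 - c.1.2)
    have e : n + c'.1.1 - c'.1.2 = n + c.1.1 - c.1.2 + 1 := by omega
    have := rem_col h m1.1 (x := n + c.1.1 - c.1.2) (by omega) (by rw [← e, e1]; exact m2.2.2)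
    rw [← e, e1] at this
    unfold toT
    omega
  · have := hc c; unfold toT; omega
  · have hk : 0 < k := by
      by_contra h0
      apply hP
      rw [← ext_zero h, ← ext_last h]
      congr 1; omega
    have h1 := pLT_iff.1 (h.2.2 ⟨0, hk⟩).1
    obtain ⟨x, hv, hx⟩ := exists_valley h1.1 h1.2
    have e0 : C (Fin.castSucc ⟨0, hk⟩) = P := by rw [← h.1]; rfl
    have e1 : C (Fin.succ ⟨0, hk⟩) = extC n k C 1 := by
      unfold extC; congr 1; ext; simp; omega
    rw [e0] at hv hx
    rw [e1] at hx
    have hxn := hv.2.1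
    have hi : 1 ≤ D n P x := by omega
    refine ⟨⟨_, mem_F' hi hxn le_rfl⟩, ?_⟩
    have e : n + D n P x - (n + D n P x - x) = x := by omega
    have a := rem_pos h hi hxn le_rfl
    have b := (rem_le_iff h hi hxn 1).2 hx
    unfold toT
    simp only [e]
    omega

theorem toT_inj {n k : ℕ} {P : Fin n → Bool} {C C' : Fin (k + 1) → Fin n → Bool}
    (h : chainP n k P C) (h' : chainP n k P C') (e : toT n k P C = toT n k P C') : C = C' := by
  funext m
  have em : ∀ B : Fin (k + 1) → Fin n → Bool, B m = extC n k B m := by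
    intro B; unfold extC; congr 1; ext; simp; omega
  rw [em C, em C']
  have hr : ∀ i x, 1 ≤ i → x ≤ n → i ≤ D n P x → rem n k C i x = rem n k C' i x := by
    intro i x hi hx hD
    have := congrFun e ⟨_, mem_F' hi hx hD⟩
    unfold toT at this
    have e : n + i - (n + i - x) = x := by omega
    simp only [e] at this
    have := rem_le h hi hx
    have := rem_le h' hi hx
    omega
  have hle : ∀ B, chainP n k P B → ∀ x ≤ n, D n (extC n k B m) x ≤ D n P x := by
    intro B hB x hx
    have := ext_anti hB x hx (Nat.zero_le (m : ℕ))
    simp only [ext_zero hB] at this; exact this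
  refine D_ext fun x hx => ?_
  have key : ∀ i, 1 ≤ i → i ≤ D n P x → (D n (extC n k C m) x < i ↔ D n (extC n k C' m) x < i) := by
    intro i hi hD
    rw [← rem_le_iff h hi hx, ← rem_le_iff h' hi hx, hr i x hi hx hD]
  have a := hle C h x hx
  have b := hle C' h' x hx
  rcases lt_trichotomy (D n (extC n k C m) x) (D n (extC n k C' m) x) with hl | hl | hl
  · have := key _ (by omega) b; omega
  · exact hl
  · have := key _ (by omega) a; omega

theorem toT_surj {n k : ℕ} {P : Fin n → Bool} (hP : P ≠ pTop n) (hk : k = deg n P)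
    {T : {c : ℕ × ℕ // c ∈ F n P} → ℕ} (h : tabP n k P T) :
    ∃ C, chainP n k P C ∧ toT n k P C = T := by
  obtain ⟨hpos, hT, hle, _⟩ := h
  have hent : ∀ i x, 1 ≤ i → x ≤ n → i ≤ D n P x → 1 ≤ ent n P T i x ∧ ent n P T i x ≤ k := by
    intro i x hi hx hD
    rw [ent_eq T (mem_F' hi hx hD)]
    exact ⟨hpos _, hle _⟩
  have honto : ∀ s, 1 ≤ s → s ≤ k → ∃ i x, 1 ≤ i ∧ x ≤ n ∧ i ≤ D n P x ∧ ent n P T i x = s := by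
    obtain ⟨i, x, a, b, c, d⟩ := deg_spec hP
    rw [← hk] at d
    exact (ent_onto hT hpos k i x a b c d).2 (hent i x a b c).2
  have hC : chainP n k P (fun m => mkP n (G n P T (k - m))) := by
    refine ⟨?_, ?_, ?_⟩
    · refine D_ext fun x hx => ?_
      rw [D_G hT _ x hx]
      refine le_antisymm (G_le ..) ?_
      rw [le_G hT hx le_rfl]
      rcases Nat.eq_zero_or_pos (D n P x) with h0 | h0
      · rw [h0, ent_zero]; omega
      · simpa using (hent _ x h0 hx le_rfl).2
    · refine D_ext fun x hx => ?_
      rw [D_G hT _ x hx, D_top]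
      by_contra h0
      have a := G_le n P T (k - (Fin.last k : ℕ)) x
      have b := (le_G hT (s := k - (Fin.last k : ℕ)) hx a).1 le_rfl
      have c := hent _ x (Nat.pos_of_ne_zero h0) hx a
      simp at b c
      omega
    · intro m
      have e : k - (m.castSucc : ℕ) = (k - (m.succ : ℕ)) + 1 := by simp; omega
      have hs : small n (mkP n (G n P T (k - (m.castSucc : ℕ)))) (mkP n (G n P T (k - (m.succ : ℕ)))) := by
        rw [e]; exact G_step hT _
      refine ⟨pLT_iff.2 ⟨pLE_of_small hs, fun hE => ?_⟩, hs⟩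
      obtain ⟨i, x, a, b, c, d⟩ := honto (k - (m.castSucc : ℕ)) (by omega) (by omega)
      have h1 := (le_G hT b c).2 d.le
      have h2 := mt (le_G hT (s := k - (m.succ : ℕ)) b c).1 (by omega)
      have h3 := congrArg (fun R => D n R x) hE
      simp only [D_G hT _ x b] at h3
      omega
  refine ⟨_, hC, ?_⟩
  funext c
  have m1 := mem_F.1 c.2
  have hx : n + c.1.1 - c.1.2 ≤ n := by omega
  have hr := fun m => rem_le_iff hC m1.1 hx m
  have hE := hent _ _ m1.1 hx m1.2.2
  rw [ent_cell] at hE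
  have hr' : ∀ m ≤ k, rem n k (fun m => mkP n (G n P T (k - m))) c.1.1 (n + c.1.1 - c.1.2) ≤ m ↔ k - m < T c := by
    intro m hm
    rw [hr m]
    unfold extC
    rw [D_G hT _ _ hx, ← ent_cell T c, ← not_le, ← not_le, ← le_G hT hx m1.2.2]
    simp [hm]
  have a := (hr' (k + 1 - T c) (by omega)).2 (by omega)
  have b := mt (hr' (k - T c) (by omega)).1 (by omega)
  unfold toT
  omega

/-- For `P` starting with a downstep, the number `f(P)` of chains with small
intervals and minimum length `δ(P)` from `P` to `u^n` equals the number of strictly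
increasing shifted tableaux of shape `λ(P)` with maximum entry `δ(P)`. -/
theorem stmt18 (n : ℕ) (P : Fin n → Bool) (hn : 0 < n)
    (hd : stp n P 1 = false) (hP : P ≠ pTop n) :
    Nat.card {C : Fin (deg n P + 1) → Fin n → Bool //
        C 0 = P ∧ C (Fin.last (deg n P)) = pTop n ∧
        ∀ i : Fin (deg n P),
          pLT n (C i.castSucc) (C i.succ) ∧ small n (C i.castSucc) (C i.succ)} =
    Nat.card {T : {c : ℕ × ℕ // c ∈ F n P} → ℕ //
        (∀ c, 0 < T c) ∧ isStrictTab n P T ∧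
        (∀ c, T c ≤ deg n P) ∧ (∃ c, T c = deg n P)} := by
  refine Nat.card_eq_of_bijective (fun C : {C // chainP n (deg n P) P C} =>
    (⟨toT n (deg n P) P C.1, toT_tab hP C.2⟩ : {T // tabP n (deg n P) P T})) ⟨?_, ?_⟩
  · intro C C' h
    exact Subtype.ext (toT_inj C.2 C'.2 (congrArg Subtype.val h))
  · rintro ⟨T, hT⟩
    obtain ⟨C, hC, e⟩ := toT_surj hP rfl hT
    exact ⟨⟨C, hC⟩, Subtype.ext e⟩
end

section
/- For every binary path P = (k_i)_{i∈[m]} of length n with P ≠ 1_n, the number of saturated chains from P to 1_n in the lattice of binary paths equals ( (λ_1 + ⋯ + λ_m)! / (λ_1!⋯λ_m!) ) · Π_{i<j} (λ_i − λ_j)/(λ_i + λ_j), where λ_i = n − i − k_i + 1. -/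
open Finset

theorem aux_lagrange (s : Finset ℕ) (y c : ℕ → ℚ) (hy : Set.InjOn y s) :
    ∑ a ∈ s, c a * ∏ b ∈ s.erase a, ((y a - y b - c b) / (y a - y b)) = ∑ a ∈ s, c a := by
  classical
  rcases s.eq_empty_or_nonempty with rfl | hs
  · simp
  have hpos : 0 < #s := hs.card_pos
  set A : Polynomial ℚ := ∏ b ∈ s, (Polynomial.X - Polynomial.C (y b + c b)) with hA
  set B : Polynomial ℚ := ∏ b ∈ s, (Polynomial.X - Polynomial.C (y b)) with hB
  have mA : A.Monic := Polynomial.monic_prod_X_sub_C _ _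
  have mB : B.Monic := Polynomial.monic_prod_X_sub_C _ _
  have dA : A.degree = #s := by
    rw [Polynomial.degree_eq_natDegree mA.ne_zero, hA, Polynomial.natDegree_finsetProd_X_sub_C_eq_card]
  have dB : B.degree = #s := by
    rw [Polynomial.degree_eq_natDegree mB.ne_zero, hB, Polynomial.natDegree_finsetProd_X_sub_C_eq_card]
  have hdeg : (B - A).degree < #s := by
    rw [← dB]
    exact Polynomial.degree_sub_lt_left (dB.trans dA.symm) mB.ne_zero (by rw [mA, mB])
  have key := Lagrange.coeff_eq_sum hy hdeg
  rw [Polynomial.coeff_sub, hA, hB, Polynomial.prod_X_sub_C_coeff_card_pred _ _ hpos,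
    Polynomial.prod_X_sub_C_coeff_card_pred _ _ hpos, sum_add_distrib] at key
  have : ∑ a ∈ s, c a = -∑ i ∈ s, y i - -(∑ i ∈ s, y i + ∑ i ∈ s, c i) := by ring
  rw [this, key]
  refine sum_congr rfl fun a ha => ?_
  rw [Polynomial.eval_sub, Polynomial.eval_prod, Polynomial.eval_prod,
    prod_eq_zero (i := a) ha (by simp), ← mul_prod_erase s _ ha, prod_div_distrib]
  simp only [Polynomial.eval_sub, Polynomial.eval_X, Polynomial.eval_C, sub_add_eq_sub_sub]
  ring

noncomputable def GG (S : Finset ℕ) : ℚ :=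
  (∏ a ∈ S, ((a.factorial : ℚ))⁻¹) *
    ∏ a ∈ S, ∏ b ∈ S, if b < a then ((a : ℚ) - b) / (a + b) else 1

theorem GG_insert (a : ℕ) (T : Finset ℕ) (ha : a ∉ T) :
    GG (insert a T) = GG T * (a.factorial : ℚ)⁻¹ * ∏ b ∈ T, (|(a : ℚ) - b| / (a + b)) := by
  unfold GG
  simp only [prod_insert ha, prod_mul_distrib, lt_irrefl, if_false, one_mul]
  have : ∏ b ∈ T, (|(a : ℚ) - b| / (a + b)) =
      (∏ b ∈ T, if b < a then ((a : ℚ) - b) / (a + b) else 1) *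
      ∏ b ∈ T, if a < b then ((b : ℚ) - a) / (b + a) else 1 := by
    rw [← prod_mul_distrib]
    refine prod_congr rfl fun b hb => ?_
    rcases lt_trichotomy b a with h | h | h
    · have h' : (b : ℚ) < a := by exact_mod_cast h
      rw [if_pos h, if_neg (by omega), abs_of_pos (by linarith), mul_one]
    · subst h; exact absurd hb ha
    · have h' : (a : ℚ) < b := by exact_mod_cast h
      rw [if_neg (by omega), if_pos h, abs_of_neg (by linarith), one_mul, neg_sub, add_comm]
  rw [this]; ring

theorem GG_insert_zero (T : Finset ℕ) (h0 : 0 ∉ T) : GG (insert 0 T) = GG T := by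
  rw [GG_insert 0 T h0]
  have : ∏ b ∈ T, (|((0 : ℕ) : ℚ) - b| / (((0 : ℕ) : ℚ) + b)) = 1 := by
    refine prod_eq_one fun b hb => ?_
    have : (b : ℚ) ≠ 0 := by
      rintro h; have : b = 0 := by exact_mod_cast h
      subst this; exact h0 hb
    simp [this]
  rw [this]; simp

theorem GG_sum (S : Finset ℕ) (h0 : 0 ∉ S) :
    ∑ a ∈ S with a - 1 ∉ S, GG (insert (a - 1) (S.erase a)) = ((∑ a ∈ S, a : ℕ) : ℚ) * GG S := by
  classical
  have hne : ∀ a ∈ S, a ≠ 0 := fun a ha h => h0 (h ▸ ha)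
  have hL := aux_lagrange S (fun a => (a : ℚ) * (a - 1)) (fun a => 2 * a) (by
    intro a ha b hb hab
    have h1 : (1 : ℚ) ≤ a := by exact_mod_cast Nat.one_le_iff_ne_zero.2 (hne a ha)
    have h2 : (1 : ℚ) ≤ b := by exact_mod_cast Nat.one_le_iff_ne_zero.2 (hne b hb)
    have h3 : ((a : ℚ) - b) * (a + b - 1) = 0 := by simp only at hab; linarith
    rcases mul_eq_zero.1 h3 with h | h
    · exact_mod_cast sub_eq_zero.1 h
    · linarith)
  have hL' : ((∑ a ∈ S, a : ℕ) : ℚ) = ∑ a ∈ S, (a : ℚ) * ∏ b ∈ S.erase a,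
      (((a : ℚ) * (a - 1) - b * (b - 1) - 2 * b) / ((a : ℚ) * (a - 1) - b * (b - 1))) := by
    push_cast
    simp only [mul_assoc, ← mul_sum] at hL
    linarith
  rw [hL', sum_mul, sum_filter]
  refine sum_congr rfl fun a ha => ?_
  have h1 : (1 : ℚ) ≤ a := by exact_mod_cast Nat.one_le_iff_ne_zero.2 (hne a ha)
  obtain ⟨k, rfl⟩ : ∃ k, a = k + 1 := ⟨a - 1, by have := hne a ha; omega⟩
  simp only [Nat.add_sub_cancel]
  by_cases h : k ∉ S
  · rw [if_pos h]
    have hk : k ∉ S.erase (k + 1) := fun h' => h (mem_of_mem_erase h')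
    conv_rhs => rw [← insert_erase ha, GG_insert _ _ (notMem_erase _ _)]
    rw [GG_insert _ _ hk, Nat.factorial_succ, erase_insert (notMem_erase _ _)]
    have hp : ∏ b ∈ S.erase (k + 1), (|(k : ℚ) - b| / (k + b)) =
       (∏ b ∈ S.erase (k+1), ((((k + 1 : ℕ) : ℚ) * (((k + 1 : ℕ) : ℚ) - 1) - b * (b - 1) - 2 * b) /
          (((k + 1 : ℕ) : ℚ) * (((k + 1 : ℕ) : ℚ) - 1) - b * (b - 1)))) *
        ∏ b ∈ S.erase (k+1), (|((k + 1 : ℕ) : ℚ) - b| / (((k + 1 : ℕ) : ℚ) + b)) := by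
      rw [← prod_mul_distrib]
      refine prod_congr rfl fun b hb => ?_
      have hb1 : (1 : ℚ) ≤ b := by
        exact_mod_cast Nat.one_le_iff_ne_zero.2 (hne b (mem_of_mem_erase hb))
      have hk0 : (0 : ℚ) ≤ k := k.cast_nonneg
      have e1 : ((k + 1 : ℕ) : ℚ) * (((k + 1 : ℕ) : ℚ) - 1) - b * (b - 1) - 2 * b
        = (k - b) * (k + 1 + b) := by push_cast; ring
      have e2 : ((k + 1 : ℕ) : ℚ) * (((k + 1 : ℕ) : ℚ) - 1) - b * (b - 1)
        = (k + b) * (k + 1 - b) := by push_cast; ring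
      rw [e1, e2]
      push_cast
      have p1 : (k : ℚ) + b ≠ 0 := by linarith
      have p2 : (k : ℚ) + 1 + b ≠ 0 := by linarith
      have hbk : b ≠ k + 1 := ne_of_mem_erase hb
      rcases lt_or_gt_of_ne hbk with h | h
      · have h' : (b : ℚ) ≤ k := by exact_mod_cast Nat.lt_succ_iff.1 h
        have p3 : (k : ℚ) + 1 - b ≠ 0 := by linarith
        rw [abs_of_nonneg (by linarith), abs_of_nonneg (by linarith)]
        field_simp
      · have h' : (k : ℚ) + 1 < b := by exact_mod_cast h
        have p3 : (k : ℚ) + 1 - b ≠ 0 := by linarith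
        rw [abs_of_nonpos (by linarith), abs_of_nonpos (by linarith)]
        field_simp
    rw [hp]
    have : ((k : ℚ) + 1) ≠ 0 := by positivity
    have : (k.factorial : ℚ) ≠ 0 := by exact_mod_cast k.factorial_ne_zero
    push_cast
    field_simp
    ring_nf
  · rw [if_neg h]
    have h := not_not.1 h
    rw [prod_eq_zero (i := k) (mem_erase.2 ⟨by omega, h⟩)]
    · simp
    · have : ((k + 1 : ℕ) : ℚ) * (((k + 1 : ℕ) : ℚ) - 1) - k * (k - 1) - 2 * k = 0 := by
        push_cast; ring
      rw [this, zero_div]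

theorem ht_zero (n : ℕ) (P : Fin n → Bool) : ht n P 0 = 0 := by simp [ht]

theorem ht_succ (n : ℕ) (P : Fin n → Bool) (x : ℕ) :
    ht n P (x + 1) = ht n P x + (if stp n P (x + 1) then (1 : ℤ) else -1) := by
  unfold ht
  rw [Finset.sum_Icc_succ_top (by omega)]

theorem stp_succ (n : ℕ) (P : Fin n → Bool) (j : Fin n) : stp n P (j + 1) = P j := by
  unfold stp
  rw [dif_pos ⟨by omega, by omega⟩]
  rfl

theorem stp_out (n : ℕ) (P : Fin n → Bool) (x : ℕ) (h : n < x) : stp n P x = true := by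
  unfold stp
  rw [dif_neg (by omega)]

/-- flip at `y` -/
def flp (n : ℕ) (P : Fin n → Bool) (y : ℕ) : Fin n → Bool :=
  fun j => if (j : ℕ) + 1 = y then true else if (j : ℕ) = y then false else P j

theorem stp_flp (n : ℕ) (P : Fin n → Bool) (y x : ℕ) (hx : 1 ≤ x) (hxn : x ≤ n) :
    stp n (flp n P y) x = if x = y then true else if x = y + 1 then false else stp n P x := by
  obtain ⟨k, rfl⟩ : ∃ k, x = k + 1 := ⟨x - 1, by omega⟩
  have h1 := stp_succ n (flp n P y) ⟨k, by omega⟩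
  have h2 := stp_succ n P ⟨k, by omega⟩
  simp only at h1 h2
  rw [h1, h2, flp]
  simp only [Nat.add_right_cancel_iff]

theorem ht_flp (n : ℕ) (P : Fin n → Bool) (y : ℕ) (hv : valley n P y) (x : ℕ) (hx : x ≤ n) :
    ht n (flp n P y) x = ht n P x + if x = y then 2 else 0 := by
  obtain ⟨h1, h2, h3, h4⟩ := hv
  induction x with
  | zero => rw [ht_zero, ht_zero, if_neg (by omega)]; rfl
  | succ x ih =>
    rw [ht_succ, ht_succ, ih (by omega), stp_flp n P y (x+1) (by omega) hx]
    by_cases a : x + 1 = y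
    · subst a
      rw [if_neg (by omega), if_pos rfl, if_pos rfl, h3]
      simp; ring
    · by_cases b : x = y
      · subst b
        have h4 : stp n P (x + 1) = true := by
          rcases h4 with h | h
          · omega
          · exact h
        rw [h4]; simp; ring
      · have a2 : ¬ (x + 1 = y + 1) := by omega
        simp only [a, b, a2, if_false]; ring

theorem eq_of_ht (n : ℕ) (P Q : Fin n → Bool) (h : ∀ x ≤ n, ht n P x = ht n Q x) : P = Q := by
  funext j
  have h1 := h j (by omega)
  have h2 := h (j + 1) (by omega)
  rw [ht_succ, ht_succ, h1, stp_succ, stp_succ] at h2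
  cases hp : P j <;> cases hq : Q j <;> simp [hp, hq] at h2 ⊢

theorem covers_flp (n : ℕ) (P : Fin n → Bool) (y : ℕ) (hv : valley n P y) :
    covers n P (flp n P y) := by
  have H := ht_flp n P y hv
  have hyn := hv.2.1
  refine ⟨⟨fun x hx => ?_, fun h => ?_⟩, ?_⟩
  · rw [H x hx]; split_ifs <;> omega
  · have := h y hyn
    rw [H y hyn, if_pos rfl] at this
    omega
  · rintro R ⟨a1, a2⟩ ⟨b1, b2⟩
    have par : ∀ x, (ht n R x - ht n P x) % 2 = 0 := by
      intro x
      induction x with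
      | zero => simp [ht_zero]
      | succ x ih => rw [ht_succ, ht_succ]; split_ifs <;> omega
    have e : ∀ x ≤ n, x ≠ y → ht n R x = ht n P x := by
      intro x hx hxy
      have := a1 x hx
      have := b1 x hx
      rw [H x hx, if_neg hxy] at this
      omega
    have k1 := a1 y hyn
    have k2 := b1 y hyn
    have k3 := par y
    rw [H y hyn, if_pos rfl] at k2
    by_cases c : ht n R y = ht n P y
    · apply a2
      intro x hx
      by_cases d : x = y
      · subst d; omega
      · rw [e x hx d]
    · apply b2
      intro x hx
      rw [H x hx]
      by_cases d : x = y
      · subst d; rw [if_pos rfl]; omega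
      · rw [e x hx d, if_neg d]; omega

theorem covers_exists (n : ℕ) (P Q : Fin n → Bool) (h : covers n P Q) :
    ∃ y, valley n P y ∧ flp n P y = Q := by
  classical
  obtain ⟨⟨h1, h2⟩, h3⟩ := h
  have par : ∀ x, (ht n Q x - ht n P x) % 2 = 0 := by
    intro x
    induction x with
    | zero => simp [ht_zero]
    | succ x ih => rw [ht_succ, ht_succ]; split_ifs <;> omega
  -- the set of candidates
  let p : ℕ → Prop := fun y => 1 ≤ y ∧ y ≤ n ∧ ht n P y < ht n Q y ∧ stp n P y = false
  have hex : ∃ y, p y := by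
    have h2' : ∃ x, x ≤ n ∧ ht n P x < ht n Q x := by
      unfold pLE at h2; push Not at h2; exact h2
    obtain ⟨x, s0, s1, s2⟩ : ∃ x, x ≤ n ∧ ht n P x < ht n Q x ∧
        ∀ m < x, ¬ (m ≤ n ∧ ht n P m < ht n Q m) :=
      ⟨Nat.find h2', (Nat.find_spec h2').1, (Nat.find_spec h2').2,
        fun m hm => Nat.find_min h2' hm⟩
    cases x with
    | zero => rw [ht_zero, ht_zero] at s1; omega
    | succ k =>
      refine ⟨k + 1, by omega, s0, s1, ?_⟩
      have t := s2 k (by omega)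
      have t : ¬ ht n P k < ht n Q k := fun h => t ⟨by omega, h⟩
      have t' := h1 k (by omega)
      rw [ht_succ, ht_succ] at s1
      by_contra hc
      rw [Bool.not_eq_false] at hc
      rw [hc, if_pos (rfl : true = true)] at s1
      split_ifs at s1 <;> omega
  have hb : ∀ y, p y → y ≤ n := fun y hy => hy.2.1
  obtain ⟨y0, hy0⟩ := hex
  have g1 := Nat.findGreatest_spec (P := p) (hb y0 hy0) hy0
  have g2 := fun k => Nat.findGreatest_is_greatest (P := p) (n := n) (k := k)
  set y := Nat.findGreatest p n
  obtain ⟨q1, q2, q3, q4⟩ := g1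
  have hv : valley n P y := by
    refine ⟨q1, q2, q4, ?_⟩
    by_contra! hc
    obtain ⟨c1, c2⟩ := hc
    rw [ne_eq, Bool.not_eq_true] at c2
    apply g2 (y + 1) (by omega) (by omega)
    refine ⟨by omega, by omega, ?_, c2⟩
    have := par y
    rw [ht_succ, ht_succ, c2]
    split_ifs <;> simp_all <;> omega
  refine ⟨y, hv, ?_⟩
  have hle : pLE n (flp n P y) Q := by
    intro x hx
    rw [ht_flp n P y hv x hx]
    have := h1 x hx
    have := par x
    split_ifs with e
    · subst e; omega
    · omega
  have hc := h3 _ (covers_flp n P y hv).1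
  have hge : pLE n Q (flp n P y) := by
    by_contra hcc
    exact hc ⟨hle, hcc⟩
  exact eq_of_ht n _ _ fun x hx => le_antisymm (hle x hx) (hge x hx)

theorem flp_inj (n : ℕ) (P : Fin n → Bool) (y z : ℕ) (hy : valley n P y) (hz : valley n P z)
    (h : flp n P y = flp n P z) : y = z := by
  have a := ht_flp n P y hy y hy.2.1
  have b := ht_flp n P z hz y hy.2.1
  rw [h, b, if_pos rfl] at a
  by_contra hc
  rw [if_neg hc] at a
  omega

theorem pLE_top (n : ℕ) (P : Fin n → Bool) : pLE n P (pTop n) := by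
  intro x hx
  induction x with
  | zero => simp [ht_zero]
  | succ x ih =>
    have := ih (by omega)
    have h2 : stp n (pTop n) (x + 1) = true := stp_succ n (pTop n) ⟨x, by omega⟩
    rw [ht_succ, ht_succ, h2, if_pos (rfl : true = true)]
    split_ifs <;> omega

/-- the set of parts -/
def prt (n : ℕ) (P : Fin n → Bool) : Finset ℕ := (dsteps n P).image fun j : Fin n => n - (j : ℕ)

theorem mem_prt (n : ℕ) (P : Fin n → Bool) (a : ℕ) :
    a ∈ prt n P ↔ 1 ≤ a ∧ a ≤ n ∧ stp n P (n + 1 - a) = false := by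
  unfold prt dsteps
  simp only [mem_image, mem_filter, mem_univ, true_and]
  constructor
  · rintro ⟨j, hj, rfl⟩
    refine ⟨by omega, by omega, ?_⟩
    rw [← hj, ← stp_succ n P j]
    congr 1; omega
  · rintro ⟨h1, h2, h3⟩
    refine ⟨⟨n - a, by omega⟩, ?_, by simp only; omega⟩
    rw [← stp_succ n P, ← h3]
    congr 1; simp only; omega

theorem zero_notMem_prt (n : ℕ) (P : Fin n → Bool) : 0 ∉ prt n P := by
  rw [mem_prt]; omega

theorem valley_iff_s19 (n : ℕ) (P : Fin n → Bool) (a : ℕ) (h1 : 1 ≤ a) (h2 : a ≤ n) :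
    valley n P (n + 1 - a) ↔ a ∈ prt n P ∧ a - 1 ∉ prt n P := by
  unfold valley
  rw [mem_prt, mem_prt]
  have e : n + 1 - (a - 1) = n + 1 - a + 1 := by omega
  rw [e]
  constructor
  · rintro ⟨_, _, h3, h4⟩
    refine ⟨⟨h1, h2, h3⟩, ?_⟩
    rintro ⟨h5, h6, h7⟩
    rcases h4 with h | h
    · omega
    · rw [h] at h7; cases h7
  · rintro ⟨⟨_, _, h3⟩, h4⟩
    refine ⟨by omega, by omega, h3, ?_⟩
    by_contra! hc
    rw [ne_eq, ne_eq, Bool.not_eq_true] at hc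
    exact h4 ⟨by omega, by omega, hc.2⟩

theorem prt_flp (n : ℕ) (P : Fin n → Bool) (a : ℕ) (h : a ∈ prt n P) (h' : a - 1 ∉ prt n P) :
    prt n (flp n P (n + 1 - a)) = (insert (a - 1) ((prt n P).erase a)).erase 0 := by
  have h0 := (mem_prt n P a).1 h
  ext b
  by_cases hb : 1 ≤ b ∧ b ≤ n
  · rw [mem_prt, stp_flp _ _ _ _ (by omega) (by omega), mem_erase, mem_insert, mem_erase, mem_prt]
    by_cases c : b = a
    · subst c; simp; omega
    · by_cases d : b = a - 1
      · subst d
        rw [if_neg (by omega), if_pos (by omega)]; simp; omega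
      · rw [if_neg (by omega), if_neg (by omega)]; simp [c, d]; omega
  · rw [mem_prt, mem_erase, mem_insert, mem_erase, mem_prt]
    omega

theorem GG_flp (n : ℕ) (P : Fin n → Bool) (a : ℕ) (h : a ∈ prt n P) (h' : a - 1 ∉ prt n P) :
    GG (prt n (flp n P (n + 1 - a))) = GG (insert (a - 1) ((prt n P).erase a)) := by
  rw [prt_flp n P a h h']
  have h0 := zero_notMem_prt n P
  by_cases c : a - 1 = 0
  · rw [c, erase_insert (by simp [h0]), GG_insert_zero _ (by simp [h0])]
  · rw [erase_eq_of_notMem]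
    simp [h0]; omega

theorem sum_flp (n : ℕ) (P : Fin n → Bool) (a : ℕ) (h : a ∈ prt n P) (h' : a - 1 ∉ prt n P) :
    ∑ b ∈ prt n (flp n P (n + 1 - a)), b + 1 = ∑ b ∈ prt n P, b := by
  rw [prt_flp n P a h h']
  have h0 := (mem_prt n P a).1 h
  rw [Finset.sum_erase (f := fun b : ℕ => b) _ rfl, sum_insert (fun hh => h' (mem_of_mem_erase hh)),
    ← add_sum_erase _ _ h]
  omega

abbrev Chn (n : ℕ) (P : Fin n → Bool) : Type := (Σ L : ℕ, {C : Fin (L + 1) → Fin n → Bool //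
        C 0 = P ∧ C (Fin.last L) = pTop n ∧
        ∀ i : Fin L, covers n (C i.castSucc) (C i.succ)})

def consChn (n : ℕ) (P : Fin n → Bool) (x : Σ Q : {Q // covers n P Q}, Chn n Q.1) : Chn n P :=
  ⟨x.2.1 + 1, Fin.cons (α := fun _ => Fin n → Bool) P x.2.2.1, by
    obtain ⟨⟨Q, hQ⟩, L, C, h1, h2, h3⟩ := x
    refine ⟨rfl, ?_, ?_⟩
    · rw [← Fin.succ_last, Fin.cons_succ]; exact h2
    · intro i
      refine Fin.cases ?_ (fun i => ?_) i
      · simp only [Fin.castSucc_zero, Fin.cons_zero, Fin.cons_succ]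
        rw [h1]; exact hQ
      · rw [← Fin.succ_castSucc, Fin.cons_succ, Fin.cons_succ]; exact h3 i⟩

theorem consChn_bij (n : ℕ) (P : Fin n → Bool) (hP : P ≠ pTop n) :
    Function.Bijective (consChn n P) := by
  constructor
  · rintro ⟨⟨Q, hQ⟩, L, C, h1, h2, h3⟩ ⟨⟨Q', hQ'⟩, L', C', h1', h2', h3'⟩ h
    simp only [consChn, Sigma.mk.injEq] at h
    obtain ⟨ha, hb⟩ := h
    have : L = L' := by omega
    subst this
    have hb := Subtype.ext_iff.1 (eq_of_heq hb)
    simp only at hb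
    have hC : C = C' := Fin.cons_right_injective (α := fun _ => Fin n → Bool) P hb
    subst hC
    have : Q = Q' := h1.symm.trans h1'
    subst this
    rfl
  · rintro ⟨L, C, h1, h2, h3⟩
    cases L with
    | zero => exact absurd (h1.symm.trans h2) hP
    | succ L =>
      refine ⟨⟨⟨C 1, ?_⟩, L, Fin.tail C, rfl, ?_, ?_⟩, ?_⟩
      · have := h3 0
        rw [Fin.castSucc_zero, h1] at this
        exact this
      · exact h2
      · intro i
        exact h3 i.succ
      · simp only [consChn]
        congr 1
        refine Subtype.ext ?_
        simp only
        rw [← h1]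
        exact Fin.cons_self_tail C

theorem chn_top (n : ℕ) : Nat.card (Chn n (pTop n)) = 1 ∧ Finite (Chn n (pTop n)) := by
  have : Unique (Chn n (pTop n)) :=
    { default := ⟨0, fun _ => pTop n, rfl, rfl, fun i => i.elim0⟩
      uniq := by
        rintro ⟨L, C, h1, h2, h3⟩
        cases L with
        | zero =>
          congr 1
          refine Subtype.ext ?_
          funext i
          have : i = 0 := Fin.ext (by have := i.2; simp only [Fin.val_zero]; omega)
          rw [this]
          exact h1
        | succ L =>
          have := (h3 0).1.2
          rw [Fin.castSucc_zero, h1] at this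
          exact absurd (pLE_top n _) this }
  exact ⟨Nat.card_unique, inferInstance⟩

theorem prt_eq_empty (n : ℕ) (P : Fin n → Bool) (h : prt n P = ∅) : P = pTop n := by
  unfold prt dsteps at h
  rw [image_eq_empty, filter_eq_empty_iff] at h
  funext j
  have := h (mem_univ j)
  simpa [pTop] using this

theorem prt_top (n : ℕ) : prt n (pTop n) = ∅ := by
  simp [prt, dsteps, pTop]

theorem main_count (n : ℕ) (N : ℕ) : ∀ P : Fin n → Bool, ∑ a ∈ prt n P, a = N →
    Finite (Chn n P) ∧ (Nat.card (Chn n P) : ℚ) = (N.factorial : ℚ) * GG (prt n P) := by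
  classical
  induction N with
  | zero =>
    intro P hP
    have : P = pTop n := by
      apply prt_eq_empty
      refine eq_empty_of_forall_notMem fun a ha => ?_
      have h1 := (sum_eq_zero_iff.1 hP) a ha
      exact zero_notMem_prt n P (h1 ▸ ha)
    subst this
    refine ⟨(chn_top n).2, ?_⟩
    rw [(chn_top n).1, prt_top]
    simp [GG]
  | succ N ih =>
    intro P hP
    have hne : P ≠ pTop n := by
      rintro rfl; rw [prt_top] at hP; simp at hP
    have hb := consChn_bij n P hne
    have hA : ∀ Q, covers n P Q → ∃ a, (a ∈ prt n P ∧ a - 1 ∉ prt n P) ∧ flp n P (n + 1 - a) = Q := by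
      intro Q hQ
      obtain ⟨y, hy, rfl⟩ := covers_exists n P Q hQ
      have : y = n + 1 - (n + 1 - y) := by have := hy.2.1; omega
      refine ⟨n + 1 - y, ?_, by rw [← this]⟩
      rw [← valley_iff_s19 n P _ (by have := hy.2.1; omega) (by have := hy.1; omega), ← this]
      exact hy
    have hv : ∀ a ∈ (prt n P).filter (fun a => a - 1 ∉ prt n P), valley n P (n + 1 - a) := by
      intro a ha
      rw [mem_filter] at ha
      have h0 := (mem_prt n P a).1 ha.1
      exact (valley_iff_s19 n P a h0.1 h0.2.1).2 ha
    have hS : ∀ Q, covers n P Q → ∑ b ∈ prt n Q, b = N := by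
      intro Q hQ
      obtain ⟨a, ⟨h1, h2⟩, rfl⟩ := hA Q hQ
      have := sum_flp n P a h1 h2
      omega
    have hfin : ∀ Q : {Q // covers n P Q}, Finite (Chn n Q.1) := fun Q =>
      (ih Q.1 (hS Q.1 Q.2)).1
    refine ⟨Finite.of_surjective _ hb.2, ?_⟩
    rw [← Nat.card_eq_of_bijective _ hb, Nat.card_sigma]
    push_cast
    rw [Finset.sum_congr rfl (fun Q _ => (ih Q.1 (hS Q.1 Q.2)).2), ← mul_sum, Nat.factorial_succ]
    have e : ∑ Q : {Q // covers n P Q}, GG (prt n Q.1) =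
        ∑ a ∈ prt n P with a - 1 ∉ prt n P, GG (insert (a - 1) ((prt n P).erase a)) := by
      symm
      refine Finset.sum_bij (fun a ha => ⟨flp n P (n + 1 - a), covers_flp n P _ (hv a ha)⟩)
        (fun _ _ => mem_univ _) ?_ ?_ ?_
      · intro a ha b hb h
        have h := flp_inj n P _ _ (hv a ha) (hv b hb) (Subtype.ext_iff.1 h)
        have h1 := (mem_prt n P a).1 (mem_filter.1 ha).1
        have h2 := (mem_prt n P b).1 (mem_filter.1 hb).1
        omega
      · rintro ⟨Q, hQ⟩ _
        obtain ⟨a, ha, rfl⟩ := hA Q hQ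
        exact ⟨a, mem_filter.2 ha, rfl⟩
      · intro a ha
        exact (GG_flp n P a (mem_filter.1 ha).1 (mem_filter.1 ha).2).symm
    rw [e, GG_sum _ (zero_notMem_prt n P), hP]
    push_cast
    ring

theorem lam_strictAnti (n : ℕ) (P : Fin n → Bool) : StrictAnti (lam n P) := by
  intro i j h
  have h1 : dpos n P i < dpos n P j := by
    unfold dpos
    have := ((dsteps n P).orderIsoOfFin rfl).strictMono h
    exact this
  have h2 : dpos n P j < n := by unfold dpos; exact Fin.isLt _
  unfold lam; omega

theorem image_lam (n : ℕ) (P : Fin n → Bool) : univ.image (lam n P) = prt n P := by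
  ext a
  unfold prt
  simp only [mem_image, mem_univ, true_and]
  constructor
  · rintro ⟨i, rfl⟩
    exact ⟨_, ((dsteps n P).orderIsoOfFin rfl i).2, rfl⟩
  · rintro ⟨j, hj, rfl⟩
    refine ⟨((dsteps n P).orderIsoOfFin rfl).symm ⟨j, hj⟩, ?_⟩
    unfold lam dpos
    rw [OrderIso.apply_symm_apply]

/-- The number of saturated chains from `P` to `u^n` equals the shifted hook-type
formula `((λ_1 + ⋯ + λ_m)! / (λ_1!⋯λ_m!)) · Π_{i<j} (λ_i − λ_j)/(λ_i + λ_j)`,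
where `λ_i = n − i − k_i + 1`. -/
theorem stmt19 (n : ℕ) (P : Fin n → Bool) (hP : P ≠ pTop n) :
    (Nat.card (Σ L : ℕ, {C : Fin (L + 1) → Fin n → Bool //
        C 0 = P ∧ C (Fin.last L) = pTop n ∧
        ∀ i : Fin L, covers n (C i.castSucc) (C i.succ)}) : ℚ) =
      ((∑ i, lam n P i).factorial : ℚ) / (∏ i, ((lam n P i).factorial : ℚ)) *
        ∏ p ∈ Finset.univ.filter
            (fun p : Fin (nd n P) × Fin (nd n P) => p.1 < p.2),
          (((lam n P p.1 : ℚ) - (lam n P p.2 : ℚ)) /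
            ((lam n P p.1 : ℚ) + (lam n P p.2 : ℚ))) := by
  have hinj : Set.InjOn (lam n P) (univ : Finset (Fin (nd n P))) :=
    (lam_strictAnti n P).injective.injOn
  have h := (main_count n _ P rfl).2
  refine h.trans ?_
  unfold GG
  rw [← image_lam, sum_image hinj, prod_image hinj, prod_image hinj, prod_filter,
    ← univ_product_univ, prod_product, prod_inv_distrib, ← mul_assoc, div_eq_mul_inv]
  congr 1
  refine prod_congr rfl fun i _ => ?_
  rw [prod_image hinj]
  refine prod_congr rfl fun j _ => ?_
  simp only [(lam_strictAnti n P).lt_iff_gt]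
end
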